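/- Let k ≥ 1 with 4 ∣ k and h ∈ ℤ with 0 ≤ h < k and gcd(h,k) = 1. Then lim_{t→0⁺} B(q(t)) = ∑_{n=0}^{k/4 − 1} ζ_k^{hn(n+1)} (−ζ_k^{2h};ζ_k^{2h})_n / (ζ_k^h;ζ_k^{2h})_{n+1}², and all denominators of this finite sum are nonzero. -/

import Mathlib

open scoped BigOperators Classical
open Filter Topology

noncomputable section

/-- finite q-Pochhammer symbol $(x;q)_n$ -/
def qPoch (x q : ℂ) (n : ℕ) : ℂ := ∏ j ∈ Finset.range n, (1 - x * q ^ j)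

/-- infinite q-Pochhammer symbol $(x;q)_\infty$ -/
def qPochInf (x q : ℂ) : ℂ := ∏' j : ℕ, (1 - x * q ^ j)

/-- $e(x) = e^{2\pi i x}$ -/
def ee (x : ℂ) : ℂ := Complex.exp (2 * Real.pi * Complex.I * x)

/-- $\zeta_n^m = e(m/n)$ -/
def zeta (m : ℤ) (n : ℕ) : ℂ := ee ((m : ℂ) / (n : ℂ))

/-- Dedekind eta -/
def eta (τ : ℂ) : ℂ := Complex.exp (Real.pi * Complex.I * τ / 12) * qPochInf (ee τ) (ee τ)

/-- Jacobi theta -/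
def theta (z τ : ℂ) : ℂ :=
  -Complex.I * Complex.exp (Real.pi * Complex.I * τ / 4) * Complex.exp (-(Real.pi * Complex.I * z))
    * qPochInf (ee τ) (ee τ) * qPochInf (ee z) (ee τ) * qPochInf ((ee z)⁻¹ * ee τ) (ee τ)

/-- universal mock theta function g₂ -/
def g2 (ζ q : ℂ) : ℂ :=
  ∑' n : ℕ, qPoch (-q) q n * q ^ (n * (n + 1) / 2) /
    (qPoch ζ q (n + 1) * qPoch (ζ⁻¹ * q) q (n + 1))

/-- universal mock theta function g₃ -/
def g3 (ζ q : ℂ) : ℂ :=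
  ∑' n : ℕ, q ^ (n * (n + 1)) / (qPoch ζ q (n + 1) * qPoch (ζ⁻¹ * q) q (n + 1))

/-- the series L -/
def Lser (ζ q : ℂ) : ℂ :=
  (1 / 2) * ∑' n : ℕ, q ^ n * qPoch (ζ⁻¹ * q) q n * qPoch ζ q n / qPoch (-q) q n

/-- the function M -/
def Mfun (z τ : ℂ) : ℂ :=
  -(Complex.I / 2) * Complex.exp (Real.pi * Complex.I * z) * theta z τ *
    g3 (-(ee z)) (ee τ) / (Complex.exp (Real.pi * Complex.I * τ / 12) * eta (2 * τ))

/-- the function T -/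
def Tfun (z τ : ℂ) : ℂ :=
  -Complex.I * eta (2 * τ) ^ 4 / (ee z * eta τ ^ 2 * theta (2 * z) (2 * τ))
  - Complex.I * eta (2 * τ) ^ 10 * theta (2 * z + 1 / 2) (2 * τ) /
      (2 * ee z ^ 2 * Complex.exp (Real.pi * Complex.I * τ / 2) * eta τ ^ 4 * eta (4 * τ) ^ 4 *
        theta (2 * z) (2 * τ) * theta (2 * z + τ + 1 / 2) (2 * τ))
  - Complex.I * eta (2 * τ) ^ 4 * theta z τ /
      (2 * Complex.exp (Real.pi * Complex.I * τ / 2) * ee z ^ 2 * eta (4 * τ) ^ 2 *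
        theta (z + 1 / 2) τ * theta (2 * z + τ + 1 / 2) (2 * τ))

/-- the function K -/
def Kfun (z τ : ℂ) : ℂ :=
  eta (2 * τ) ^ 4 / (Complex.I * ee z * eta τ ^ 2 * theta (2 * z) (2 * τ))

/-- Zwegers' μ-function -/
def mu (z₁ z₂ τ : ℂ) : ℂ :=
  Complex.exp (Real.pi * Complex.I * z₁) / theta z₂ τ *
    ∑' n : ℤ, (-(ee z₂)) ^ n * Complex.exp (Real.pi * Complex.I * (n : ℂ) * ((n : ℂ) + 1) * τ) /
      (1 - ee z₁ * (ee τ) ^ n)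

/-- the Appell–Lerch sum A -/
def appell (ζ q : ℂ) : ℂ :=
  ∑' n : ℤ, (-1 : ℂ) ^ n * q ^ ((3 * n * (n + 1)) / 2) / (1 + ζ * q ^ n)

/-- the function Θ -/
def bigTheta (z₁ z₂ z τ : ℂ) : ℂ :=
  (1 / (2 * Real.pi * Complex.I)) * deriv (fun w => theta w τ) 0 *
    theta (z₁ + z₂ + z) τ * theta z τ /
    (theta z₁ τ * theta z₂ τ * theta (z₁ + z) τ * theta (z₂ + z) τ)

/-- the function 𝔱 -/
def tfrak (z τ : ℂ) : ℂ :=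
  Kfun z τ - Complex.I * Kfun (z + 1 / 4) (τ + 1 / 2) +
    Complex.I * Complex.exp (-(Real.pi * Complex.I * τ / 2)) * bigTheta (2 * z) τ (1 / 2) (2 * τ)

/-- the second order mock theta function B -/
def mockB (q : ℂ) : ℂ :=
  ∑' n : ℕ, q ^ n * qPoch (-q) (q ^ 2) n / qPoch q (q ^ 2) (n + 1)

/-- Ramanujan's third order mock theta function f -/
def mockf (q : ℂ) : ℂ := ∑' n : ℕ, q ^ (n ^ 2) / qPoch (-q) q n ^ 2

/-- the modular form b -/
def bfun (q : ℂ) : ℂ := qPochInf q q / qPochInf (-q) q ^ 2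

/-- τ(t) = h/k + it/(2π) -/
def tauT (h k : ℕ) (t : ℝ) : ℂ := (h : ℂ) / (k : ℂ) + Complex.I * (t : ℂ) / (2 * Real.pi)

/-- q(t) = e^{2πiτ(t)} -/
def qT (h k : ℕ) (t : ℝ) : ℂ := ee (tauT h k t)

lemma qPoch_succ (x q : ℂ) (n : ℕ) : qPoch x q (n + 1) = qPoch x q n * (1 - x * q ^ n) :=
  Finset.prod_range_succ _ _

lemma qPoch_succ' (x q : ℂ) (n : ℕ) : qPoch x q (n + 1) = (1 - x) * qPoch (x * q) q n := by
  unfold qPoch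
  rw [Finset.prod_range_succ', mul_comm, pow_zero, mul_one]
  congr 1
  exact Finset.prod_congr rfl fun j _ => by ring

@[fun_prop]
lemma Continuous.qPoch {X : Type*} [TopologicalSpace X] {f g : X → ℂ} (hf : Continuous f)
    (hg : Continuous g) (n : ℕ) : Continuous fun x => qPoch (f x) (g x) n := by
  unfold _root_.qPoch
  fun_prop

lemma one_sub_ne_zero_of_norm_lt_one {x : ℂ} (hx : ‖x‖ < 1) : 1 - x ≠ 0 := by
  intro h
  rw [← sub_eq_zero.mp h] at hx
  simp at hx

lemma norm_mul_pow_lt_one {x q : ℂ} (hx : ‖x‖ < 1) (hq : ‖q‖ ≤ 1) (n : ℕ) : ‖x * q ^ n‖ < 1 := by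
  rw [norm_mul, norm_pow]
  exact (mul_le_of_le_one_right (norm_nonneg _) (pow_le_one₀ (norm_nonneg _) hq)).trans_lt hx

lemma qPoch_ne_zero_of_norm_lt_one {x q : ℂ} (hx : ‖x‖ < 1) (hq : ‖q‖ ≤ 1) (n : ℕ) :
    qPoch x q n ≠ 0 :=
  Finset.prod_ne_zero_iff.mpr fun j _ =>
    one_sub_ne_zero_of_norm_lt_one (norm_mul_pow_lt_one hx hq j)

/-- The deformation of the defining series of `mockB` in a free parameter `c`;
`c = q` gives `mockB q`. -/
def mockBSeries (q c : ℂ) : ℂ :=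
  ∑' n : ℕ, c ^ n * qPoch (-q) (q ^ 2) n / qPoch c (q ^ 2) (n + 1)

lemma norm_sq_lt_one {q : ℂ} (hq : ‖q‖ < 1) : ‖q ^ 2‖ < 1 := by
  rw [norm_pow]
  exact pow_lt_one₀ (norm_nonneg _) hq two_ne_zero

lemma summable_mockBSeries {q c : ℂ} (hq : ‖q‖ < 1) (hc : ‖c‖ < 1) (hc0 : c ≠ 0) :
    Summable fun n : ℕ => c ^ n * qPoch (-q) (q ^ 2) n / qPoch c (q ^ 2) (n + 1) := by
  have hq2 := norm_sq_lt_one hq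
  have hnum (n : ℕ) : qPoch (-q) (q ^ 2) n ≠ 0 :=
    qPoch_ne_zero_of_norm_lt_one (by rwa [norm_neg]) hq2.le n
  have hden (n : ℕ) : qPoch c (q ^ 2) n ≠ 0 := qPoch_ne_zero_of_norm_lt_one hc hq2.le n
  refine summable_of_ratio_test_tendsto_lt_one hc (Eventually.of_forall fun n =>
    div_ne_zero (mul_ne_zero (pow_ne_zero _ hc0) (hnum n)) (hden _)) ?_
  have hpow : Tendsto (fun n : ℕ => (q ^ 2) ^ n) atTop (𝓝 0) :=
    tendsto_pow_atTop_nhds_zero_of_norm_lt_one hq2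
  have hlim : Tendsto (fun n : ℕ => ‖c * (1 - -q * (q ^ 2) ^ n) / (1 - c * (q ^ 2) ^ (n + 1))‖)
      atTop (𝓝 ‖c * (1 - -q * 0) / (1 - c * 0)‖) :=
    ((tendsto_const_nhds.mul (tendsto_const_nhds.sub (tendsto_const_nhds.mul hpow))).div
      (tendsto_const_nhds.sub (tendsto_const_nhds.mul
        ((tendsto_add_atTop_iff_nat 1).mpr hpow))) (by simp)).norm
  simp only [mul_zero, sub_zero, mul_one, div_one] at hlim
  refine hlim.congr fun n => ?_
  rw [← norm_div, qPoch_succ (-q), qPoch_succ c _ (n + 1)]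
  congr 1
  have h1 := hnum n
  have h2 := hden (n + 1)
  have h3 : 1 - c * (q ^ 2) ^ (n + 1) ≠ 0 :=
    one_sub_ne_zero_of_norm_lt_one (norm_mul_pow_lt_one hc hq2.le _)
  field_simp
  ring

/-- A contiguous relation of Fine. -/
lemma mockBSeries_eq {q c : ℂ} (hq : ‖q‖ < 1) (hc : ‖c‖ < 1) (hc0 : c ≠ 0) :
    mockBSeries q c =
      (1 + c * q * (1 + c * q) * mockBSeries q (c * q ^ 2)) / (1 - c) ^ 2 := by
  have hq2 := norm_sq_lt_one hq
  have hcq : ‖c * q ^ 2‖ < 1 := by simpa using norm_mul_pow_lt_one hc hq.le 2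
  have h1c := one_sub_ne_zero_of_norm_lt_one hc
  have hs := summable_mockBSeries hq hc hc0
  have hterm (n : ℕ) :
      c ^ (n + 1) * qPoch (-q) (q ^ 2) (n + 1) / qPoch c (q ^ 2) (n + 1 + 1) -
        c * (c ^ n * qPoch (-q) (q ^ 2) n / qPoch c (q ^ 2) (n + 1)) =
      c * q * (1 + c * q) / (1 - c) *
        ((c * q ^ 2) ^ n * qPoch (-q) (q ^ 2) n / qPoch (c * q ^ 2) (q ^ 2) (n + 1)) := by
    rw [qPoch_succ' c _ (n + 1), qPoch_succ' c _ n, qPoch_succ (-q), qPoch_succ (c * q ^ 2)]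
    have h1 : qPoch (c * q ^ 2) (q ^ 2) n ≠ 0 := qPoch_ne_zero_of_norm_lt_one hcq hq2.le n
    have h2 : 1 - c * q ^ 2 * (q ^ 2) ^ n ≠ 0 :=
      one_sub_ne_zero_of_norm_lt_one (norm_mul_pow_lt_one hcq hq2.le n)
    rw [mul_pow c]
    generalize (q ^ 2) ^ n = y at *
    generalize hd : 1 - c * q ^ 2 * y = d at *
    field_simp
    rw [← hd]
    ring
  have hshift := hs.tsum_eq_zero_add
  have hdiff := (((summable_nat_add_iff 1).mpr hs).tsum_sub (hs.mul_left c)).symm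
  simp only [hterm, tsum_mul_left] at hdiff
  rw [eq_div_iff (pow_ne_zero 2 h1c)]
  unfold mockBSeries
  set A := ∑' n : ℕ, c ^ n * qPoch (-q) (q ^ 2) n / qPoch c (q ^ 2) (n + 1)
  have h0 : c ^ 0 * qPoch (-q) (q ^ 2) 0 / qPoch c (q ^ 2) (0 + 1) = 1 / (1 - c) := by
    simp [qPoch]
  rw [h0, ← sub_eq_iff_eq_add'] at hshift
  rw [← hshift] at hdiff
  field_simp at hdiff
  linear_combination hdiff

lemma mockB_eq_sum_add {q : ℂ} (hq : ‖q‖ < 1) (hq0 : q ≠ 0) (N : ℕ) :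
    mockB q =
      ∑ n ∈ Finset.range N,
        q ^ (n * (n + 1)) * qPoch (-q ^ 2) (q ^ 2) n / qPoch q (q ^ 2) (n + 1) ^ 2 +
      q ^ (N * (N + 1)) * qPoch (-q ^ 2) (q ^ 2) N / qPoch q (q ^ 2) N ^ 2 *
        mockBSeries q (q ^ (2 * N + 1)) := by
  induction N with
  | zero => simp [qPoch, mockB, mockBSeries]
  | succ N ih =>
    have hc : ‖q ^ (2 * N + 1)‖ < 1 := by
      rw [norm_pow]
      exact pow_lt_one₀ (norm_nonneg _) hq (by omega)
    have h1 : 1 - q ^ (2 * N + 1) ≠ 0 := one_sub_ne_zero_of_norm_lt_one hc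
    have h2 : qPoch q (q ^ 2) N ≠ 0 :=
      qPoch_ne_zero_of_norm_lt_one hq (norm_sq_lt_one hq).le N
    rw [ih, mockBSeries_eq hq hc (pow_ne_zero _ hq0), Finset.sum_range_succ, add_assoc]
    congr 1
    rw [qPoch_succ, qPoch_succ]
    have e1 : q ^ (2 * N + 1) * q ^ 2 = q ^ (2 * (N + 1) + 1) := by ring
    have e2 : q * (q ^ 2) ^ N = q ^ (2 * N + 1) := by ring
    have e3 : -q ^ 2 * (q ^ 2) ^ N = -(q ^ (2 * N + 1) * q) := by ring
    have e4 : q ^ ((N + 1) * (N + 1 + 1)) = q ^ (N * (N + 1)) * (q ^ (2 * N + 1) * q) := by ring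
    rw [e1, e2, e3, e4]
    generalize mockBSeries q (q ^ (2 * (N + 1) + 1)) = H
    generalize q ^ (2 * N + 1) = c at *
    field_simp
    ring

/-- If `y ^ m` is a non-positive real, then `y` stays away from `1`. -/
lemma one_le_mul_norm_one_sub {y : ℂ} {m : ℕ} {x : ℝ} (hy : ‖y‖ ≤ 1) (hx : 0 ≤ x)
    (h : y ^ m = -(x : ℂ)) : 1 ≤ m * ‖1 - y‖ := by
  have h1 : (1 : ℝ) ≤ ‖1 - y ^ m‖ := by
    rw [h, sub_neg_eq_add]
    have : (1 : ℂ) + x = ((1 + x : ℝ) : ℂ) := by push_cast; rfl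
    rw [this, Complex.norm_real, Real.norm_of_nonneg (by linarith)]
    linarith
  refine h1.trans ?_
  rw [← mul_neg_geom_sum, norm_mul, mul_comm]
  gcongr
  refine (norm_sum_le _ _).trans ?_
  calc ∑ i ∈ Finset.range m, ‖y ^ i‖ ≤ ∑ i ∈ Finset.range m, (1 : ℝ) := by
        refine Finset.sum_le_sum fun i _ => ?_
        rw [norm_pow]
        exact pow_le_one₀ (norm_nonneg _) hy
    _ = m := by simp

lemma sum_range_sub_shift_le {f : ℕ → ℝ} (h0 : ∀ n, 0 ≤ f n) (h1 : ∀ n, f n ≤ 1) (N n : ℕ) :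
    ∑ j ∈ Finset.range n, (f j - f (j + N)) ≤ N := by
  have e := Finset.sum_range_add f N n
  have e' := Finset.sum_range_add f n N
  rw [Finset.sum_sub_distrib]
  have e1 : ∑ j ∈ Finset.range N, f j ≤ N := by
    simpa using Finset.sum_le_sum (s := Finset.range N) fun j _ => h1 j
  have e2 : 0 ≤ ∑ j ∈ Finset.range N, f (n + j) := Finset.sum_nonneg fun j _ => h0 _
  simp only [add_comm _ N]
  rw [add_comm] at e'
  linarith

section RootOfUnity

variable {ζ : ℂ} {l : ℕ}

lemma norm_eq_one_of_pow_eq_neg_one {m : ℕ} (hm : m ≠ 0) (hζ : ζ ^ m = -1) : ‖ζ‖ = 1 :=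
  (pow_eq_one_iff_of_nonneg (norm_nonneg _) hm).mp (by rw [← norm_pow, hζ]; simp)

lemma one_le_mul_norm_one_sub_odd_pow (hl : l ≠ 0) (hζ : ζ ^ (2 * l) = -1) (a : ℕ) {x : ℝ}
    (hx0 : 0 ≤ x) (hx1 : x ≤ 1) : 1 ≤ (2 * l) * ‖1 - ζ ^ (2 * a + 1) * x‖ := by
  have hn := norm_eq_one_of_pow_eq_neg_one (by omega) hζ
  have := one_le_mul_norm_one_sub (y := ζ ^ (2 * a + 1) * x) (m := 2 * l) (x := x ^ (2 * l))
    (by simpa [hn, abs_of_nonneg hx0] using hx1) (by positivity) (by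
      rw [mul_pow, ← pow_mul, mul_comm (2 * a + 1), pow_mul, hζ, Odd.neg_one_pow (by simp)]
      push_cast
      ring)
  exact_mod_cast this

lemma qPoch_ne_zero_of_pow_eq_neg_one (hl : l ≠ 0) (hζ : ζ ^ (2 * l) = -1) (n : ℕ) :
    qPoch ζ (ζ ^ 2) n ≠ 0 := by
  refine Finset.prod_ne_zero_iff.mpr fun j _ h => ?_
  have := one_le_mul_norm_one_sub_odd_pow hl hζ j zero_le_one le_rfl
  have e : ζ ^ (2 * j + 1) = ζ * (ζ ^ 2) ^ j := by ring
  rw [Complex.ofReal_one, mul_one, e, h] at this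
  norm_num at this

lemma qPoch_eq_zero_of_pow_eq_neg_one (hl : l ≠ 0) (hζ : ζ ^ (2 * l) = -1) {n : ℕ} (hn : l ≤ n) :
    qPoch (-ζ ^ 2) (ζ ^ 2) n = 0 := by
  obtain ⟨l, rfl⟩ := Nat.exists_eq_succ_of_ne_zero hl
  refine Finset.prod_eq_zero (Finset.mem_range.mpr hn) ?_
  have e : 1 - -ζ ^ 2 * (ζ ^ 2) ^ l = 1 + ζ ^ (2 * l.succ) := by rw [Nat.succ_eq_add_one]; ring
  rw [e, hζ]
  ring

lemma norm_mockBSeries_le (hl : l ≠ 0) (hζ : ζ ^ (2 * l) = -1) {N : ℕ} (hN : ζ ^ (2 * N) = -1)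
    {r : ℝ} (hr0 : 0 < r) (hr1 : r < 1) :
    ‖mockBSeries (ζ * r) ((ζ * r) ^ (2 * N + 1))‖ ≤
      (2 * l) * Real.exp ((2 * l) * N) * (1 - r)⁻¹ := by
  have hn := norm_eq_one_of_pow_eq_neg_one (by omega) hζ
  have hden (a : ℕ) : 1 ≤ (2 * l) * ‖1 - (ζ * r) ^ (2 * a + 1)‖ := by
    have := one_le_mul_norm_one_sub_odd_pow hl hζ a (x := r ^ (2 * a + 1)) (by positivity)
      (pow_le_one₀ hr0.le hr1.le)
    rw [mul_pow]
    exact_mod_cast this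
  have hfactor (j : ℕ) : ‖1 + (ζ * r) ^ (2 * j + 1)‖ ≤
      ‖1 - (ζ * r) ^ (2 * (j + N) + 1)‖ *
        Real.exp ((2 * l) * (r ^ (2 * j + 1) - r ^ (2 * (j + N) + 1))) := by
    set d := r ^ (2 * j + 1) - r ^ (2 * (j + N) + 1) with hd
    have hd0 : 0 ≤ d := sub_nonneg.mpr (pow_le_pow_of_le_one hr0.le hr1.le (by omega))
    have e : 1 + (ζ * r) ^ (2 * j + 1) =
        (1 - (ζ * r) ^ (2 * (j + N) + 1)) - ζ ^ (2 * (j + N) + 1) * (d : ℝ) := by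
      have : ζ ^ (2 * (j + N) + 1) = -ζ ^ (2 * j + 1) := by
        rw [show 2 * (j + N) + 1 = 2 * j + 1 + 2 * N by ring, pow_add, hN]
        ring
      rw [mul_pow, mul_pow, this, hd]
      push_cast
      ring
    calc ‖1 + (ζ * r) ^ (2 * j + 1)‖
        ≤ ‖1 - (ζ * r) ^ (2 * (j + N) + 1)‖ + d := by
          rw [e]
          refine (norm_sub_le _ _).trans_eq ?_
          simp [hn, abs_of_nonneg hd0]
      _ ≤ ‖1 - (ζ * r) ^ (2 * (j + N) + 1)‖ * (1 + (2 * l) * d) := by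
          nlinarith [hden (j + N)]
      _ ≤ _ := by
          gcongr
          rw [add_comm]
          exact Real.add_one_le_exp _
  have hprod (n : ℕ) : ‖qPoch (-(ζ * r)) ((ζ * r) ^ 2) n‖ ≤
      ‖qPoch ((ζ * r) ^ (2 * N + 1)) ((ζ * r) ^ 2) n‖ * Real.exp ((2 * l) * N) := by
    unfold qPoch
    rw [norm_prod, norm_prod]
    calc ∏ j ∈ Finset.range n, ‖1 - -(ζ * r) * ((ζ * r) ^ 2) ^ j‖
        ≤ ∏ j ∈ Finset.range n, (‖1 - (ζ * r) ^ (2 * N + 1) * ((ζ * r) ^ 2) ^ j‖ *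
            Real.exp ((2 * l) * (r ^ (2 * j + 1) - r ^ (2 * (j + N) + 1)))) := by
          refine Finset.prod_le_prod (fun _ _ => norm_nonneg _) fun j _ => ?_
          rw [show 1 - -(ζ * r) * ((ζ * r) ^ 2) ^ j = 1 + (ζ * r) ^ (2 * j + 1) by ring,
            show (ζ * r) ^ (2 * N + 1) * ((ζ * r) ^ 2) ^ j = (ζ * r) ^ (2 * (j + N) + 1) by ring]
          exact hfactor j
      _ ≤ _ := by
          rw [Finset.prod_mul_distrib, ← Real.exp_sum, ← Finset.mul_sum]
          gcongr
          exact sum_range_sub_shift_le (f := fun j => r ^ (2 * j + 1)) (fun _ => by positivity)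
            (fun _ => pow_le_one₀ hr0.le hr1.le) N n
  have hqr : ‖ζ * r‖ = r := by simp [hn, abs_of_pos hr0]
  refine tsum_of_norm_bounded ((hasSum_geometric_of_lt_one hr0.le hr1).mul_left
    ((2 * l) * Real.exp ((2 * l) * N))) fun n => ?_
  have hE : qPoch ((ζ * r) ^ (2 * N + 1)) ((ζ * r) ^ 2) n ≠ 0 := by
    refine qPoch_ne_zero_of_norm_lt_one ?_ (norm_sq_lt_one (hqr.trans_lt hr1)).le n
    rw [norm_pow, hqr]
    exact pow_lt_one₀ hr0.le hr1 (by omega)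
  have hlast : 1 ≤ (2 * l) * ‖1 - (ζ * r) ^ (2 * N + 1) * ((ζ * r) ^ 2) ^ n‖ := by
    convert hden (n + N) using 4
    ring
  have hlast0 : 0 < ‖1 - (ζ * r) ^ (2 * N + 1) * ((ζ * r) ^ 2) ^ n‖ := by
    by_contra! hneg
    nlinarith
  rw [qPoch_succ, norm_div, norm_mul, norm_mul, norm_pow, norm_pow, hqr,
    div_le_iff₀ (mul_pos (norm_pos_iff.mpr hE) hlast0), ← pow_mul]
  have hpow : r ^ ((2 * N + 1) * n) ≤ r ^ n :=
    pow_le_pow_of_le_one hr0.le hr1.le (by nlinarith)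
  calc r ^ ((2 * N + 1) * n) * ‖qPoch (-(ζ * r)) ((ζ * r) ^ 2) n‖
      ≤ r ^ n * (‖qPoch ((ζ * r) ^ (2 * N + 1)) ((ζ * r) ^ 2) n‖ *
          Real.exp ((2 * l) * N)) * 1 := by
        rw [mul_one]
        exact mul_le_mul hpow (hprod n) (norm_nonneg _) (by positivity)
    _ ≤ r ^ n * (‖qPoch ((ζ * r) ^ (2 * N + 1)) ((ζ * r) ^ 2) n‖ *
          Real.exp ((2 * l) * N)) *
          ((2 * l) * ‖1 - (ζ * r) ^ (2 * N + 1) * ((ζ * r) ^ 2) ^ n‖) := by gcongr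
    _ = _ := by ring

/-- The extra factor `1 - r ^ (6 * l)` cancels the growth of the tail series. -/
lemma norm_one_sub_pow_mul_mockBSeries_le (hl : l ≠ 0) (hζ : ζ ^ (2 * l) = -1) {r : ℝ}
    (hr0 : 0 < r) (hr1 : r < 1) :
    ‖(1 + (ζ * r) ^ (6 * l)) * mockBSeries (ζ * r) ((ζ * r) ^ (2 * (3 * l) + 1))‖ ≤
      (6 * l) * ((2 * l) * Real.exp ((2 * l) * (3 * l : ℕ))) := by
  have h3 : ζ ^ (2 * (3 * l)) = -1 := by
    rw [show 2 * (3 * l) = 2 * l * 3 by ring, pow_mul, hζ]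
    norm_num
  have hH := norm_mockBSeries_le hl hζ h3 hr0 hr1
  have hr : 0 < 1 - r := sub_pos.mpr hr1
  have h1 : ‖1 + (ζ * r) ^ (6 * l)‖ ≤ (6 * l) * (1 - r) := by
    have hb := one_add_mul_le_pow (a := r - 1) (by linarith) (6 * l)
    rw [mul_pow, show 6 * l = 2 * (3 * l) by ring, h3, neg_one_mul, ← sub_eq_add_neg,
      ← Complex.ofReal_pow, ← Complex.ofReal_one, ← Complex.ofReal_sub, Complex.norm_real,
      Real.norm_of_nonneg (sub_nonneg.mpr (pow_le_one₀ hr0.le hr1.le)),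
      show 2 * (3 * l) = 6 * l by ring]
    push_cast at hb
    rw [add_sub_cancel] at hb
    linarith
  rw [norm_mul]
  refine (mul_le_mul h1 hH (norm_nonneg _) (by positivity)).trans_eq ?_
  field_simp

lemma tendsto_mockB_radial (hl : l ≠ 0) (hζ : ζ ^ (2 * l) = -1) :
    Tendsto (fun r : ℝ => mockB (ζ * r)) (𝓝[<] 1)
      (𝓝 (∑ n ∈ Finset.range l,
        ζ ^ (n * (n + 1)) * qPoch (-ζ ^ 2) (ζ ^ 2) n / qPoch ζ (ζ ^ 2) (n + 1) ^ 2)) := by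
  have hn := norm_eq_one_of_pow_eq_neg_one (by omega) hζ
  have hζ0 : ζ ≠ 0 := by
    rw [← norm_ne_zero_iff, hn]
    exact one_ne_zero
  have hlim {f : ℂ → ℂ} (hf : ContinuousAt f ζ) :
      Tendsto (fun r : ℝ => f (ζ * r)) (𝓝[<] 1) (𝓝 (f ζ)) := by
    refine hf.tendsto.comp (tendsto_nhdsWithin_of_tendsto_nhds ?_)
    have : Continuous fun r : ℝ => ζ * (r : ℂ) := by fun_prop
    simpa using this.tendsto 1
  have hmem : ∀ᶠ r : ℝ in 𝓝[<] 1, r ∈ Set.Ioo 0 1 := Ioo_mem_nhdsLT one_pos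
  have hsum : Tendsto (fun r : ℝ => ∑ n ∈ Finset.range (3 * l),
      (ζ * r) ^ (n * (n + 1)) * qPoch (-(ζ * r) ^ 2) ((ζ * r) ^ 2) n /
        qPoch (ζ * r) ((ζ * r) ^ 2) (n + 1) ^ 2) (𝓝[<] 1)
      (𝓝 (∑ n ∈ Finset.range l,
        ζ ^ (n * (n + 1)) * qPoch (-ζ ^ 2) (ζ ^ 2) n / qPoch ζ (ζ ^ 2) (n + 1) ^ 2)) := by
    rw [Finset.sum_subset (Finset.range_subset_range.mpr (by omega : l ≤ 3 * l)) fun n _ h => by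
      rw [qPoch_eq_zero_of_pow_eq_neg_one hl hζ (by simpa using h), mul_zero, zero_div]]
    refine tendsto_finsetSum _ fun n _ => ?_
    refine hlim (f := fun q => q ^ (n * (n + 1)) * qPoch (-q ^ 2) (q ^ 2) n /
      qPoch q (q ^ 2) (n + 1) ^ 2) (ContinuousAt.div ?_ ?_ ?_)
    · exact Continuous.continuousAt (by fun_prop)
    · exact Continuous.continuousAt (by fun_prop)
    · exact pow_ne_zero 2 (qPoch_ne_zero_of_pow_eq_neg_one hl hζ _)
  have hrem : Tendsto (fun r : ℝ => (ζ * r) ^ (3 * l * (3 * l + 1)) *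
      qPoch (-(ζ * r) ^ 2) ((ζ * r) ^ 2) (3 * l - 1) / qPoch (ζ * r) ((ζ * r) ^ 2) (3 * l) ^ 2)
      (𝓝[<] 1) (𝓝 0) := by
    have := hlim (f := fun q => q ^ (3 * l * (3 * l + 1)) * qPoch (-q ^ 2) (q ^ 2) (3 * l - 1) /
      qPoch q (q ^ 2) (3 * l) ^ 2) (ContinuousAt.div (Continuous.continuousAt (by fun_prop))
        (Continuous.continuousAt (by fun_prop))
        (pow_ne_zero 2 (qPoch_ne_zero_of_pow_eq_neg_one hl hζ _)))
    simpa [qPoch_eq_zero_of_pow_eq_neg_one hl hζ (show l ≤ 3 * l - 1 by omega)] using this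
  have hprod := hrem.zero_mul_isBoundedUnder_le
    (g := fun r : ℝ => (1 + (ζ * r) ^ (6 * l)) *
      mockBSeries (ζ * r) ((ζ * r) ^ (2 * (3 * l) + 1)))
    (isBoundedUnder_of_eventually_le (hmem.mono fun r hr =>
      norm_one_sub_pow_mul_mockBSeries_le hl hζ hr.1 hr.2))
  rw [← add_zero (∑ n ∈ Finset.range l, _)]
  refine (hsum.add hprod).congr' (hmem.mono fun r hr => ?_)
  have hq : ‖ζ * (r : ℂ)‖ < 1 := by simpa [hn, abs_of_pos hr.1] using hr.2
  beta_reduce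
  rw [mockB_eq_sum_add hq (mul_ne_zero hζ0 (by exact_mod_cast hr.1.ne')) (3 * l)]
  congr 1
  obtain ⟨p, hp⟩ : ∃ p, 3 * l = p + 1 := ⟨3 * l - 1, by omega⟩
  rw [show 6 * l = 2 * (p + 1) by omega, hp, Nat.add_sub_cancel, qPoch_succ (-(ζ * r) ^ 2)]
  ring

end RootOfUnity

lemma ee_add (x y : ℂ) : ee (x + y) = ee x * ee y := by
  unfold ee
  rw [← Complex.exp_add]
  congr 1
  ring

lemma zeta_two_mul (m : ℤ) (n : ℕ) : zeta (2 * m) n = zeta m n ^ 2 := by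
  unfold zeta
  rw [sq, ← ee_add]
  congr 1
  push_cast
  ring

lemma zeta_pow_eq_neg_one {h l : ℕ} (hl : l ≠ 0) (hh : Odd h) :
    zeta h (4 * l) ^ (2 * l) = -1 := by
  have e : ((2 * l : ℕ) : ℂ) * (2 * Real.pi * Complex.I * (((h : ℤ) : ℂ) / ((4 * l : ℕ) : ℂ))) =
      h * (Real.pi * Complex.I) := by
    have : (l : ℂ) ≠ 0 := by exact_mod_cast hl
    push_cast
    field_simp
    ring
  unfold zeta ee
  rw [← Complex.exp_nat_mul, e, Complex.exp_nat_mul, Complex.exp_pi_mul_I, hh.neg_one_pow]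

lemma qT_eq (h k : ℕ) (t : ℝ) : qT h k t = zeta h k * (Real.exp (-t) : ℝ) := by
  unfold qT tauT zeta
  rw [ee_add]
  congr 1
  unfold ee
  rw [Complex.ofReal_exp]
  congr 1
  have : (Real.pi : ℂ) ≠ 0 := by exact_mod_cast Real.pi_ne_zero
  field_simp
  rw [Complex.I_sq]
  push_cast
  ring

/-- Lemma 6.1 (ii): radial limit of B at cusps with 4 ∣ k. -/
theorem statement15 (h k : ℕ) (hk : 1 ≤ k) (h4 : 4 ∣ k) (hhk : h < k)
    (hghk : Nat.gcd h k = 1) :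
    (∀ n : ℕ, n < k / 4 → qPoch (zeta h k) (zeta (2 * (h : ℤ)) k) (n + 1) ≠ 0) ∧
    Filter.Tendsto (fun t : ℝ => mockB (qT h k t)) (𝓝[>] (0 : ℝ))
      (𝓝 (∑ n ∈ Finset.range (k / 4),
        (zeta h k) ^ (n * (n + 1)) * qPoch (-(zeta (2 * (h : ℤ)) k)) (zeta (2 * (h : ℤ)) k) n /
          qPoch (zeta h k) (zeta (2 * (h : ℤ)) k) (n + 1) ^ 2)) := by
  obtain ⟨l, rfl⟩ := h4
  have hl : l ≠ 0 := by omega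
  have hh : Odd h := by
    refine Nat.not_even_iff_odd.mp fun he => ?_
    have := Nat.dvd_gcd he.two_dvd (show 2 ∣ 4 * l by omega)
    omega
  have hζ := zeta_pow_eq_neg_one hl hh
  rw [Nat.mul_div_cancel_left l four_pos, zeta_two_mul]
  refine ⟨fun n _ => qPoch_ne_zero_of_pow_eq_neg_one hl hζ _, ?_⟩
  simp only [qT_eq]
  refine (tendsto_mockB_radial hl hζ).comp
    (tendsto_nhdsWithin_of_tendsto_nhds_of_eventually_within _ ?_ ?_)
  · have : Continuous fun t : ℝ => Real.exp (-t) := by fun_prop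
    refine tendsto_nhdsWithin_of_tendsto_nhds ?_
    simpa using this.tendsto 0
  · filter_upwards [self_mem_nhdsWithin] with t ht
    simpa using ht

end
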